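/- If S₀ is an initial configuration and S₀ →* S, then there is a tight configuration S' such that τ_{S'} = τ_S and S ⇒* S'. -/

import Mathlib

open scoped Classical

noncomputable section

/-- A configuration: each bin holds a list of colors (bottom to top) of length at most `h`. -/
def Config {B C : Type*} (h : ℕ) (S : B → List C) : Prop := ∀ b, (S b).length ≤ h

/-- An initial configuration: every bin is full (length `h`) or empty. -/
def InitConfig {B C : Type*} (h : ℕ) (S : B → List C) : Prop :=
  ∀ b, (S b).length = h ∨ (S b).length = 0

/-- A sorted (goal) configuration: every bin is empty or monochromatically full. -/
def SortedConfig {B C : Type*} (h : ℕ) (S : B → List C) : Prop :=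
  ∀ b, S b = [] ∨ ∃ c, S b = List.replicate h c

/-- A ball-move from `S` to `S'`. -/
def BallMove {B C : Type*} (h : ℕ) (S S' : B → List C) : Prop :=
  ∃ b₁ b₂ c, b₁ ≠ b₂ ∧
    S b₁ = S' b₁ ++ [c] ∧
    (S b₂ = [] ∨ (S b₂).getLast? = some c) ∧
    S' b₂ = S b₂ ++ [c] ∧ (S' b₂).length ≤ h ∧
    ∀ b, b ≠ b₁ → b ≠ b₂ → S' b = S b

/-- A water-move from `S` to `S'`. -/
def WaterMove {B C : Type*} (h : ℕ) (S S' : B → List C) : Prop :=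
  ∃ b₁ b₂ c m, 1 ≤ m ∧ b₁ ≠ b₂ ∧
    S b₁ = S' b₁ ++ List.replicate m c ∧
    (S b₂ = [] ∨ (S b₂).getLast? = some c) ∧
    S' b₂ = S b₂ ++ List.replicate m c ∧ (S' b₂).length ≤ h ∧
    ((S' b₁).getLast? ≠ some c ∨ (S' b₂).length = h) ∧
    ∀ b, b ≠ b₁ → b ≠ b₂ → S' b = S b

/-- `i` is a border of the list `α` (1-indexed): `i = 0`, or `1 ≤ i < |α|` and `α[i] ≠ α[i+1]`. -/
def IsBorder {C : Type*} (α : List C) (i : ℕ) : Prop :=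
  i = 0 ∨ (1 ≤ i ∧ i < α.length ∧ α[i-1]? ≠ α[i]?)

/-- The set `D(α)` of borders of `α`. -/
def borders {C : Type*} (α : List C) : Finset ℕ :=
  (Finset.range (α.length + 1)).filter (IsBorder α)

/-- The top border `max D(α)` of a list. -/
def topBorder {C : Type*} (α : List C) : ℕ := (borders α).sup id

/-- The top-border table `τ_S` of a configuration. -/
def tbt {B C : Type*} (S : B → List C) : B → ℕ := fun b => topBorder (S b)

/-- `F_c(τ)`: the number of units of color `c` above the borders of `τ` in `S₀`. -/
def Fcnt {B C : Type*} [Fintype B] (h : ℕ) (S₀ : B → List C) (τ : B → ℕ) (c : C) : ℕ :=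
  ∑ b, ((Finset.Icc (τ b + 1) h).filter (fun i => (S₀ b)[i-1]? = some c)).card

/-- `B_ε(τ)`: the bins whose top border is `0`. -/
def Beps {B : Type*} [Fintype B] (τ : B → ℕ) : Finset B :=
  Finset.univ.filter (fun b => τ b = 0)

/-- `B_c(τ)`: the non-monochrome bins whose top color is `c` (determined from `S₀`). -/
def Bcol {B C : Type*} [Fintype B] (S₀ : B → List C) (τ : B → ℕ) (c : C) : Finset B :=
  Finset.univ.filter (fun b => τ b ≠ 0 ∧ (S₀ b)[τ b]? = some c)

/-- `G_c(τ) = Σ_{b ∈ B_c(τ)} (h − τ(b))`. -/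
def Gcnt {B C : Type*} [Fintype B] (h : ℕ) (S₀ : B → List C) (τ : B → ℕ) (c : C) : ℕ :=
  ∑ b ∈ Bcol S₀ τ c, (h - τ b)

/-- `M_c(τ) = max(0, ⌈(F_c(τ) − G_c(τ))/h⌉)`. -/
def Mcnt {B C : Type*} [Fintype B] (h : ℕ) (S₀ : B → List C) (τ : B → ℕ) (c : C) : ℕ :=
  (⌈((Fcnt h S₀ τ c : ℚ) - (Gcnt h S₀ τ c : ℚ)) / (h : ℚ)⌉).toNat

/-- `M_c^b(τ) = max(0, ⌈(F_c(τ) − G_c(τ) + (h − τ(b)))/h⌉)`. -/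
def McntB {B C : Type*} [Fintype B] (h : ℕ) (S₀ : B → List C) (τ : B → ℕ) (c : C) (b : B) : ℕ :=
  (⌈((Fcnt h S₀ τ c : ℚ) - (Gcnt h S₀ τ c : ℚ) + ((h : ℚ) - (τ b : ℚ))) / (h : ℚ)⌉).toNat

/-- A configuration `S` is consistent with `S₀`. -/
def Consistent {B C : Type*} [Fintype B] [Fintype C] (h : ℕ) (S₀ S : B → List C) : Prop :=
  ∑ c : C, Mcnt h S₀ (tbt S) c ≤ (Beps (tbt S)).card

/-- `S` is tight (relative to `S₀`): for every color `c` there are exactly `M_c(τ_S)`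
nonempty monochrome bins of color `c`. -/
def Tight {B C : Type*} [Fintype B] [Fintype C] (h : ℕ) (S₀ S : B → List C) : Prop :=
  ∀ c : C,
    (Finset.univ.filter (fun b => S b ≠ [] ∧ ∀ x ∈ S b, x = c)).card = Mcnt h S₀ (tbt S) c

/-- The move `τ ↝_b τ'` on top-border tables (relative to `S₀`). -/
def TBMove {B C : Type*} [Fintype B] [Fintype C] (h : ℕ) (S₀ : B → List C)
    (τ τ' : B → ℕ) (b : B) : Prop :=
  (∀ a, a ≠ b → τ a = τ' a) ∧ 0 < τ b ∧
  τ' b = ((borders (S₀ b)).filter (fun i => i < τ b)).sup id ∧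
  ∑ c : C, McntB h S₀ τ c b ≤ (Beps τ).card

/-- The move `τ ↝ τ'`: `τ ↝_b τ'` for some bin `b`. -/
def TBStep {B C : Type*} [Fintype B] [Fintype C] (h : ℕ) (S₀ : B → List C)
    (τ τ' : B → ℕ) : Prop :=
  ∃ b, TBMove h S₀ τ τ' b

end

theorem isBorder_append_replicate {C : Type*} {α : List C} {c : C} {i : ℕ} (m : ℕ)
    (hα : α = [] ∨ α.getLast? = some c) :
    IsBorder (α ++ List.replicate m c) i ↔ IsBorder α i := by
  rcases Nat.eq_zero_or_pos i with rfl | hi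
  · simp [IsBorder]
  have key : α.length ≤ i → i < α.length + m →
      (α ++ List.replicate m c)[i - 1]? = (α ++ List.replicate m c)[i]? := by
    intro h₁ h₂
    have hr : (α ++ List.replicate m c)[i]? = some c := by
      rw [List.getElem?_append_right h₁, List.getElem?_replicate]
      exact if_pos (by omega)
    rw [hr]
    rcases hα with rfl | hα
    · simp only [List.nil_append, List.length_nil] at *
      rw [List.getElem?_replicate]
      exact if_pos (by omega)
    · by_cases h₃ : i = α.length
      · subst h₃
        rw [List.getElem?_append_left (by omega), ← List.getLast?_eq_getElem?, hα]
      · rw [List.getElem?_append_right (by omega), List.getElem?_replicate]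
        exact if_pos (by omega)
  by_cases hlt : i < α.length
  · have h₁ : i - 1 < α.length := by omega
    simp only [IsBorder, List.length_append, List.length_replicate,
      List.getElem?_append_left hlt, List.getElem?_append_left h₁]
    constructor <;> rintro (h | ⟨h, -, h'⟩)
    · exact .inl h
    · exact .inr ⟨h, hlt, h'⟩
    · exact .inl h
    · exact .inr ⟨h, by omega, h'⟩
  · constructor <;> rintro (h | ⟨h, h', h''⟩)
    · omega
    · simp only [List.length_append, List.length_replicate] at h'
      exact absurd (key (by omega) h') h''
    · omega
    · omega

theorem IsBorder.append_right {C : Type*} {α : List C} {i : ℕ} (γ : List C)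
    (hi : IsBorder α i) : IsBorder (α ++ γ) i := by
  rcases hi with h | ⟨h, h', h''⟩
  · exact .inl h
  · refine .inr ⟨h, by simp; omega, ?_⟩
    rwa [List.getElem?_append_left h', List.getElem?_append_left (by omega)]

theorem isBorder_topBorder {C : Type*} (α : List C) : IsBorder α (topBorder α) := by
  have hne : (borders α).Nonempty := ⟨0, by simp [borders, IsBorder]⟩
  obtain ⟨i, hi, h⟩ := Finset.exists_mem_eq_sup (borders α) hne id
  rw [topBorder, h]
  exact (Finset.mem_filter.1 hi).2

theorem IsBorder.le_topBorder {C : Type*} {α : List C} {i : ℕ} (hi : IsBorder α i) :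
    i ≤ topBorder α := by
  have hmem : i ∈ borders α := by
    refine Finset.mem_filter.2 ⟨Finset.mem_range.2 ?_, hi⟩
    rcases hi with h | ⟨-, h, -⟩ <;> omega
  exact Finset.le_sup (f := id) hmem

theorem topBorder_append_replicate {C : Type*} {α : List C} {c : C} (m : ℕ)
    (hα : α = [] ∨ α.getLast? = some c) :
    topBorder (α ++ List.replicate m c) = topBorder α :=
  le_antisymm ((isBorder_append_replicate m hα).1 (isBorder_topBorder _)).le_topBorder
    ((isBorder_append_replicate m hα).2 (isBorder_topBorder _)).le_topBorder

theorem topBorder_replicate {C : Type*} (n : ℕ) (c : C) :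
    topBorder (List.replicate n c) = 0 := by
  have h := topBorder_append_replicate (α := []) (c := c) n (.inl rfl)
  rcases isBorder_topBorder ([] : List C) with h' | ⟨-, h', -⟩
  · simpa [h'] using h
  · simp at h'

/-- Above its top border, a list is constant. -/
theorem drop_topBorder_eq_replicate {C : Type*} {α : List C} {e : C}
    (he : α[topBorder α]? = some e) :
    α.drop (topBorder α) = List.replicate (α.length - topBorder α) e := by
  have key : ∀ j, topBorder α + j < α.length → α[topBorder α + j]? = some e := by
    intro j
    induction j with
    | zero => exact fun _ => he
    | succ j ih =>
      intro hj
      by_contra hne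
      have hb : IsBorder α (topBorder α + (j + 1)) := by
        refine .inr ⟨by omega, hj, ?_⟩
        have h₁ : topBorder α + (j + 1) - 1 = topBorder α + j := by omega
        rw [h₁, ih (by omega)]
        exact fun h => hne h.symm
      have := hb.le_topBorder
      omega
  apply List.ext_getElem?
  intro j
  rw [List.getElem?_drop, List.getElem?_replicate]
  split_ifs with hj
  · exact key j (by omega)
  · exact List.getElem?_eq_none (by omega)

theorem card_filter_range_getElem? {C : Type*} (β : List C) (c : C) (n : ℕ) :
    ((Finset.range n).filter (fun i => β[i]? = some c)).card = (β.take n).count c := by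
  induction n with
  | zero => simp
  | succ n ih =>
    rw [Finset.range_add_one, Finset.filter_insert, List.take_add_one, List.count_append, ← ih]
    rcases hβ : β[n]? with _ | e
    · simp
    · by_cases hec : e = c <;> simp [hec]

theorem card_filter_Icc_getElem? {C : Type*} {β : List C} (c : C) {t h : ℕ}
    (hβ : β.length ≤ h) :
    ((Finset.Icc (t + 1) h).filter (fun i => β[i - 1]? = some c)).card =
      (β.drop t).count c := by
  have h₁ : ((Finset.Icc (t + 1) h).filter (fun i => β[i - 1]? = some c)).card =
      ((Finset.range (h - t)).filter (fun i => (β.drop t)[i]? = some c)).card := by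
    refine Finset.card_bij' (fun i _ => i - (t + 1)) (fun i _ => i + (t + 1)) ?_ ?_ ?_ ?_
    · intro i hi
      simp only [Finset.mem_filter, Finset.mem_Icc, Finset.mem_range, List.getElem?_drop] at hi ⊢
      refine ⟨by omega, ?_⟩
      rw [← hi.2]; congr 1; omega
    · intro i hi
      simp only [Finset.mem_filter, Finset.mem_Icc, Finset.mem_range, List.getElem?_drop] at hi ⊢
      refine ⟨by omega, ?_⟩
      rw [← hi.2]; congr 1; omega
    · intro i hi
      simp only [Finset.mem_filter, Finset.mem_Icc] at hi
      omega
    · intro i hi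
      omega
  rw [h₁, card_filter_range_getElem?, List.take_of_length_le (by simp; omega)]

/-- Move `m` units of color `c` from `b₁` to `b₂`, not necessarily as many as possible. -/
structure Pour {B C : Type*} (h : ℕ) (S S' : B → List C) (b₁ b₂ : B) (c : C) (m : ℕ) :
    Prop where
  ne : b₁ ≠ b₂
  source : S b₁ = S' b₁ ++ List.replicate m c
  top : S b₂ = [] ∨ (S b₂).getLast? = some c
  target : S' b₂ = S b₂ ++ List.replicate m c
  length_le : (S' b₂).length ≤ h
  other : ∀ b, b ≠ b₁ → b ≠ b₂ → S' b = S b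

/-- The invariants of the configurations reachable from `S₀`. -/
structure Reachlike {B C : Type*} [Fintype B] (h : ℕ) (S₀ S : B → List C) : Prop where
  config : Config h S
  take_eq : ∀ b i, 1 ≤ i → IsBorder (S b) i → (S b).take (i + 1) = (S₀ b).take (i + 1)
  count_eq : ∀ c : C, ∑ b, (S b).count c = ∑ b, (S₀ b).count c

theorem Pour.sum_count_eq {B C : Type*} [Fintype B] {h : ℕ} {S S' : B → List C} {b₁ b₂ : B}
    {c : C} {m : ℕ} (hp : Pour h S S' b₁ b₂ c m) (d : C) :
    ∑ b, (S' b).count d = ∑ b, (S b).count d := by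
  have hmem : b₂ ∈ Finset.univ.erase b₁ := Finset.mem_erase.2 ⟨hp.ne.symm, Finset.mem_univ _⟩
  rw [← Finset.add_sum_erase _ _ (Finset.mem_univ b₁), ← Finset.add_sum_erase _ _ hmem,
    ← Finset.add_sum_erase _ (fun b => (S b).count d) (Finset.mem_univ b₁),
    ← Finset.add_sum_erase _ (fun b => (S b).count d) hmem, hp.source, hp.target,
    List.count_append, List.count_append]
  have : ∑ b ∈ (Finset.univ.erase b₁).erase b₂, (S' b).count d =
      ∑ b ∈ (Finset.univ.erase b₁).erase b₂, (S b).count d := by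
    refine Finset.sum_congr rfl fun b hb => ?_
    simp only [Finset.mem_erase, Finset.mem_univ, and_true] at hb
    rw [hp.other b hb.2 hb.1]
  omega

theorem Reachlike.pour {B C : Type*} [Fintype B] {h : ℕ} {S₀ S S' : B → List C} {b₁ b₂ : B}
    {c : C} {m : ℕ} (hS : Reachlike h S₀ S) (hp : Pour h S S' b₁ b₂ c m) :
    Reachlike h S₀ S' where
  config b := by
    by_cases h₁ : b = b₁
    · subst h₁
      have := hS.config b
      rw [hp.source, List.length_append] at this
      omega
    by_cases h₂ : b = b₂
    · exact h₂ ▸ hp.length_le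
    · rw [hp.other b h₁ h₂]
      exact hS.config b
  take_eq b i hi hb := by
    have hlt : i < (S' b).length := by
      rcases hb with h | ⟨-, h, -⟩ <;> omega
    by_cases h₁ : b = b₁
    · subst h₁
      rw [← hS.take_eq b i hi (hp.source ▸ hb.append_right _), hp.source,
        List.take_append_of_le_length (by omega)]
    by_cases h₂ : b = b₂
    · subst h₂
      rw [hp.target] at hb ⊢
      have hb' := (isBorder_append_replicate m hp.top).1 hb
      have hlt' : i < (S b).length := by
        rcases hb' with h | ⟨-, h, -⟩ <;> omega
      rw [List.take_append_of_le_length (by omega)]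
      exact hS.take_eq b i hi hb'
    · rw [hp.other b h₁ h₂] at hb ⊢
      exact hS.take_eq b i hi hb
  count_eq d := (hp.sum_count_eq d).trans (hS.count_eq d)

theorem reachlike_of_reflTransGen {B C : Type*} [Fintype B] {h : ℕ} {S₀ S : B → List C}
    (hInit : InitConfig h S₀) (hreach : Relation.ReflTransGen (BallMove h) S₀ S) :
    Reachlike h S₀ S := by
  induction hreach with
  | refl =>
    refine ⟨fun b => ?_, fun _ _ _ _ => rfl, fun _ => rfl⟩
    rcases hInit b with h | h <;> omega
  | tail _ hmove ih =>
    obtain ⟨b₁, b₂, c, hne, hs, ht, ht', hl, ho⟩ := hmove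
    exact ih.pour (m := 1) ⟨hne, by simpa using hs, ht, by simpa using ht', hl, ho⟩

/-- The nonempty monochrome bins of color `c`. -/
noncomputable def monoBins {B C : Type*} [Fintype B] (S : B → List C) (c : C) : Finset B :=
  Finset.univ.filter (fun b => S b ≠ [] ∧ ∀ x ∈ S b, x = c)

theorem eq_replicate_of_mem_monoBins {B C : Type*} [Fintype B] {S : B → List C} {c : C} {b : B}
    (hb : b ∈ monoBins S c) : S b = List.replicate (S b).length c :=
  List.eq_replicate_iff.2 ⟨rfl, (Finset.mem_filter.1 hb).2.2⟩

theorem tbt_eq_zero_of_mem_monoBins {B C : Type*} [Fintype B] {S : B → List C} {c : C} {b : B}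
    (hb : b ∈ monoBins S c) : tbt S b = 0 := by
  rw [tbt, eq_replicate_of_mem_monoBins hb, topBorder_replicate]

theorem getLast?_of_mem_monoBins {B C : Type*} [Fintype B] {S : B → List C} {c : C} {b : B}
    (hb : b ∈ monoBins S c) : (S b).getLast? = some c := by
  have h := (Finset.mem_filter.1 hb).2
  rw [List.getLast?_eq_some_getLast h.1, h.2 _ (List.getLast_mem h.1)]

theorem Reachlike.take_tbt {B C : Type*} [Fintype B] {h : ℕ} {S₀ S : B → List C}
    (hS : Reachlike h S₀ S) (b : B) : (S b).take (tbt S b) = (S₀ b).take (tbt S b) := by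
  rcases Nat.eq_zero_or_pos (tbt S b) with h₀ | h₀
  · simp [h₀]
  · have := congrArg (List.take (tbt S b)) (hS.take_eq b _ h₀ (isBorder_topBorder _))
    simpa [List.take_take] using this

theorem Reachlike.getElem?_tbt {B C : Type*} [Fintype B] {h : ℕ} {S₀ S : B → List C}
    (hS : Reachlike h S₀ S) {b : B} (hb : tbt S b ≠ 0) :
    ∃ e, (S b)[tbt S b]? = some e ∧ (S₀ b)[tbt S b]? = some e := by
  have hbor : IsBorder (S b) (tbt S b) := isBorder_topBorder _
  have hlt : tbt S b < (S b).length := by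
    rcases hbor with h | ⟨-, h, -⟩
    · exact absurd h hb
    · exact h
  refine ⟨_, List.getElem?_eq_getElem hlt, ?_⟩
  have := congrArg (fun l => l[tbt S b]?) (hS.take_eq b _ (Nat.pos_of_ne_zero hb) hbor)
  simp only [List.getElem?_take, Nat.lt_succ_self, if_true] at this
  rw [← this, List.getElem?_eq_getElem hlt]

theorem Reachlike.drop_tbt_of_mem_Bcol {B C : Type*} [Fintype B] {h : ℕ} {S₀ S : B → List C}
    (hS : Reachlike h S₀ S) {b : B} {c : C} (hb : b ∈ Bcol S₀ (tbt S) c) :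
    tbt S b < (S b).length ∧
      (S b).drop (tbt S b) = List.replicate ((S b).length - tbt S b) c := by
  obtain ⟨h₀, hc⟩ := (Finset.mem_filter.1 hb).2
  obtain ⟨e, he, he'⟩ := hS.getElem?_tbt h₀
  obtain rfl : e = c := Option.some_injective _ (he'.symm.trans hc)
  exact ⟨(List.getElem?_eq_some_iff.1 he).1, drop_topBorder_eq_replicate he⟩

theorem Reachlike.getLast?_of_mem_Bcol {B C : Type*} [Fintype B] {h : ℕ} {S₀ S : B → List C}
    (hS : Reachlike h S₀ S) {b : B} {c : C} (hb : b ∈ Bcol S₀ (tbt S) c) :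
    (S b).getLast? = some c := by
  obtain ⟨hlt, hd⟩ := hS.drop_tbt_of_mem_Bcol hb
  rw [← List.take_append_drop (tbt S b) (S b), hd, List.getLast?_append, List.getLast?_replicate,
    if_neg (by omega)]
  rfl

/-- The units of color `c` above the top borders sit in the bins with top color `c`. -/
theorem Reachlike.Fcnt_eq {B C : Type*} [Fintype B] {h : ℕ} {S₀ S : B → List C}
    (hInit : InitConfig h S₀) (hS : Reachlike h S₀ S) (c : C) :
    Fcnt h S₀ (tbt S) c = ∑ b ∈ Bcol S₀ (tbt S) c, ((S b).length - tbt S b) +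
      ∑ b ∈ monoBins S c, (S b).length := by
  have hF : Fcnt h S₀ (tbt S) c = ∑ b, ((S₀ b).drop (tbt S b)).count c := by
    refine Finset.sum_congr rfl fun b _ => card_filter_Icc_getElem? c ?_
    rcases hInit b with h | h <;> omega
  have hsplit : ∀ T : B → List C, ∑ b, (T b).count c =
      ∑ b, ((T b).take (tbt S b)).count c + ∑ b, ((T b).drop (tbt S b)).count c := by
    intro T
    rw [← Finset.sum_add_distrib]
    refine Finset.sum_congr rfl fun b _ => ?_
    rw [← List.count_append, List.take_append_drop]
  have hdrop : ∑ b, ((S b).drop (tbt S b)).count c =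
      ∑ b, ((S₀ b).drop (tbt S b)).count c := by
    have h₁ := hS.count_eq c
    rw [hsplit S, hsplit S₀] at h₁
    simp only [hS.take_tbt] at h₁
    omega
  rw [hF, ← hdrop, Bcol, monoBins, Finset.sum_filter, Finset.sum_filter,
    ← Finset.sum_add_distrib]
  refine Finset.sum_congr rfl fun b _ => ?_
  by_cases h₀ : tbt S b = 0
  · simp only [h₀, ne_eq, not_true_eq_false, false_and, if_false, List.drop_zero, zero_add]
    rcases hl : S b with _ | ⟨e, l⟩
    · simp
    · have he : (S b)[topBorder (S b)]? = some e := by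
        change (S b)[tbt S b]? = some e
        simp [h₀, hl]
      have hr := drop_topBorder_eq_replicate he
      change (S b).drop (tbt S b) = List.replicate ((S b).length - tbt S b) e at hr
      rw [h₀, List.drop_zero, Nat.sub_zero] at hr
      rw [← hl]
      by_cases hec : e = c
      · subst hec
        have hx : ∀ x ∈ S b, x = e := (List.eq_replicate_iff.1 hr).2
        rw [if_pos ⟨by simp [hl], hx⟩, hr]
        simp
      · rw [if_neg (fun hx => hec (hx.2 e (by simp [hl]))), hr, List.count_replicate]
        simp [hec]
  · obtain ⟨e, he, he'⟩ := hS.getElem?_tbt h₀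
    have hd : (S b).drop (tbt S b) = List.replicate ((S b).length - tbt S b) e :=
      drop_topBorder_eq_replicate he
    have hm : ¬ (S b ≠ [] ∧ ∀ x ∈ S b, x = c) := fun hx =>
      h₀ (tbt_eq_zero_of_mem_monoBins (Finset.mem_filter.2 ⟨Finset.mem_univ _, hx⟩))
    rw [if_neg hm, hd, he', List.count_replicate]
    simp [h₀]

theorem Mcnt_le_iff {B C : Type*} [Fintype B] {h : ℕ} (hh : 1 ≤ h) (S₀ : B → List C)
    (τ : B → ℕ) (c : C) (n : ℕ) :
    Mcnt h S₀ τ c ≤ n ↔ Fcnt h S₀ τ c ≤ Gcnt h S₀ τ c + n * h := by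
  have hpos : (0 : ℚ) < h := by exact_mod_cast hh
  rw [Mcnt, Int.toNat_le, Int.ceil_le, div_le_iff₀ hpos, sub_le_iff_le_add']
  norm_cast

theorem Reachlike.Mcnt_le_card_monoBins {B C : Type*} [Fintype B] {h : ℕ} (hh : 1 ≤ h)
    {S₀ S : B → List C} (hInit : InitConfig h S₀) (hS : Reachlike h S₀ S) (c : C) :
    Mcnt h S₀ (tbt S) c ≤ (monoBins S c).card := by
  rw [Mcnt_le_iff hh, hS.Fcnt_eq hInit c]
  refine add_le_add (Finset.sum_le_sum fun b _ => ?_) ?_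
  · exact Nat.sub_le_sub_right (hS.config b) _
  · exact Finset.sum_le_card_nsmul _ _ _ fun b _ => hS.config b

/-- If there are too many monochrome bins of color `c`, then one of them can be poured
somewhere else. -/
theorem Reachlike.exists_target {B C : Type*} [Fintype B] {h : ℕ} (hh : 1 ≤ h)
    {S₀ S : B → List C} (hInit : InitConfig h S₀) (hS : Reachlike h S₀ S) {c : C}
    (hlt : Mcnt h S₀ (tbt S) c < (monoBins S c).card) {b : B} (hb : b ∈ monoBins S c) :
    ∃ a, a ≠ b ∧ (S a).getLast? = some c ∧ (S a).length < h := by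
  by_contra! hfull
  have hF := (Mcnt_le_iff hh S₀ (tbt S) c ((monoBins S c).card - 1)).1 (by omega)
  rw [hS.Fcnt_eq hInit c, ← Finset.add_sum_erase _ _ hb, ← Finset.card_erase_of_mem hb] at hF
  have h₁ : Gcnt h S₀ (tbt S) c ≤ ∑ b ∈ Bcol S₀ (tbt S) c, ((S b).length - tbt S b) := by
    refine Finset.sum_le_sum fun a ha => Nat.sub_le_sub_right ?_ _
    refine hfull a ?_ (hS.getLast?_of_mem_Bcol ha)
    rintro rfl
    exact (Finset.mem_filter.1 ha).2.1 (tbt_eq_zero_of_mem_monoBins hb)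
  have h₂ : ((monoBins S c).erase b).card * h ≤
      ∑ b ∈ (monoBins S c).erase b, (S b).length := by
    refine Finset.card_nsmul_le_sum _ _ _ fun a ha => ?_
    obtain ⟨hne, ha⟩ := Finset.mem_erase.1 ha
    exact hfull a hne (getLast?_of_mem_monoBins ha)
  have h₃ : 0 < (S b).length := List.length_pos_iff.2 (Finset.mem_filter.1 hb).2.1
  omega

theorem Pour.tbt_eq {B C : Type*} [Fintype B] {h : ℕ} {S S' : B → List C} {b₁ b₂ : B} {c : C}
    {m : ℕ} (hp : Pour h S S' b₁ b₂ c m) (hb : b₁ ∈ monoBins S c) : tbt S' = tbt S := by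
  funext b
  by_cases h₁ : b = b₁
  · subst h₁
    have hx : S' b = List.replicate (S' b).length c := by
      refine List.eq_replicate_iff.2 ⟨rfl, fun x hx => (Finset.mem_filter.1 hb).2.2 x ?_⟩
      rw [hp.source]
      exact List.mem_append_left _ hx
    rw [tbt_eq_zero_of_mem_monoBins hb, tbt, hx, topBorder_replicate]
  by_cases h₂ : b = b₂
  · subst h₂
    rw [tbt, hp.target, topBorder_append_replicate m hp.top, tbt]
  · rw [tbt, hp.other b h₁ h₂, tbt]

theorem Pour.monoBins_eq {B C : Type*} [Fintype B] {h : ℕ} {S S' : B → List C} {b₁ b₂ : B}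
    {c : C} {m : ℕ} (hp : Pour h S S' b₁ b₂ c m) (hb : b₁ ∈ monoBins S c) (h₁ : S' b₁ ≠ [])
    (h₂ : S b₂ ≠ []) : monoBins S' c = monoBins S c := by
  refine Finset.filter_congr fun b _ => ?_
  by_cases hb₁ : b = b₁
  · subst hb₁
    refine iff_of_true ⟨h₁, fun x hx => (Finset.mem_filter.1 hb).2.2 x ?_⟩
      (Finset.mem_filter.1 hb).2
    rw [hp.source]
    exact List.mem_append_left _ hx
  by_cases hb₂ : b = b₂
  · subst hb₂
    rw [hp.target]
    constructor
    · exact fun hx => ⟨h₂, fun x hm => hx.2 x (List.mem_append_left _ hm)⟩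
    · refine fun hx => ⟨by simp [h₂], fun x hm => ?_⟩
      rcases List.mem_append.1 hm with hm | hm
      · exact hx.2 x hm
      · exact List.eq_of_mem_replicate hm
  · rw [hp.other b hb₁ hb₂]

/-- Emptying a superfluous monochrome bin by water-moves. -/
theorem Reachlike.exists_drain {B C : Type*} [Fintype B] {h : ℕ} (hh : 1 ≤ h)
    {S₀ : B → List C} (hInit : InitConfig h S₀) {c : C} {b : B} (n : ℕ) :
    ∀ S : B → List C, (S b).length = n → Reachlike h S₀ S →
      Mcnt h S₀ (tbt S) c < (monoBins S c).card → b ∈ monoBins S c →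
      ∃ S' : B → List C, Reachlike h S₀ S' ∧ tbt S' = tbt S ∧
        Relation.ReflTransGen (WaterMove h) S S' ∧
        (Finset.univ.filter (fun a => S' a ≠ [])).card <
          (Finset.univ.filter (fun a => S a ≠ [])).card := by
  induction n using Nat.strong_induction_on with
  | _ n ih =>
  intro S hn hS hlt hb
  obtain ⟨a, hab, hlast, hlen⟩ := hS.exists_target hh hInit hlt hb
  have hane : S a ≠ [] := by
    rintro h
    simp [h] at hlast
  have hbne : S b ≠ [] := (Finset.mem_filter.1 hb).2.1
  have hnpos : 0 < n := hn ▸ List.length_pos_iff.2 hbne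
  have hrep : S b = List.replicate n c := hn ▸ eq_replicate_of_mem_monoBins hb
  obtain ⟨m, hm⟩ : ∃ m, m = min n (h - (S a).length) := ⟨_, rfl⟩
  let S' : B → List C := fun x =>
    if x = b then List.replicate (n - m) c
    else if x = a then S a ++ List.replicate m c else S x
  have hS'b : S' b = List.replicate (n - m) c := if_pos rfl
  have hS'a : S' a = S a ++ List.replicate m c := by simp [S', hab]
  have hp : Pour h S S' b a c m := by
    refine ⟨hab.symm, ?_, .inr hlast, hS'a, ?_, fun x h₁ h₂ => by simp [S', h₁, h₂]⟩
    · rw [hS'b, hrep, List.replicate_append_replicate]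
      congr 1
      omega
    · rw [hS'a, List.length_append, List.length_replicate]
      omega
  have htbt := hp.tbt_eq hb
  have hS' := hS.pour hp
  have hwater : WaterMove h S S' := by
    refine ⟨b, a, c, m, by omega, hp.ne, hp.source, hp.top, hp.target, hp.length_le, ?_,
      hp.other⟩
    by_cases hmn : m = n
    · left
      simp [hS'b, hmn]
    · right
      rw [hS'a, List.length_append, List.length_replicate]
      omega
  have hsub : Finset.univ.filter (fun x => S' x ≠ []) ⊆
      Finset.univ.filter (fun x => S x ≠ []) := by
    intro x hx
    simp only [Finset.mem_filter, Finset.mem_univ, true_and] at hx ⊢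
    by_cases h₁ : x = b
    · exact h₁ ▸ hbne
    by_cases h₂ : x = a
    · exact h₂ ▸ hane
    · rwa [hp.other x h₁ h₂] at hx
  by_cases hmn : m = n
  · refine ⟨S', hS', htbt, .single hwater, Finset.card_lt_card ?_⟩
    refine (Finset.ssubset_iff_of_subset hsub).2 ⟨b, by simp [hbne], ?_⟩
    simp [hS'b, hmn]
  · have hne : S' b ≠ [] := by
      rw [hS'b, Ne, List.replicate_eq_nil_iff]
      omega
    have hmono := hp.monoBins_eq hb hne hane
    obtain ⟨T, hT, hTt, hTw, hTc⟩ := ih (n - m) (by omega) S' (by simp [hS'b]) hS'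
      (by rw [htbt, hmono]; exact hlt) (hmono ▸ hb)
    exact ⟨T, hT, hTt.trans htbt, .head hwater hTw,
      hTc.trans_le (Finset.card_le_card hsub)⟩

theorem Reachlike.exists_tight {B C : Type*} [Fintype B] [Fintype C] {h : ℕ} (hh : 1 ≤ h)
    {S₀ : B → List C} (hInit : InitConfig h S₀) (n : ℕ) :
    ∀ S : B → List C, (Finset.univ.filter (fun a => S a ≠ [])).card = n → Reachlike h S₀ S →
      ∃ S' : B → List C, Config h S' ∧ Tight h S₀ S' ∧ tbt S' = tbt S ∧
        Relation.ReflTransGen (WaterMove h) S S' := by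
  induction n using Nat.strong_induction_on with
  | _ n ih =>
  intro S hn hS
  by_cases htight : Tight h S₀ S
  · exact ⟨S, hS.config, htight, rfl, .refl⟩
  obtain ⟨c, hc⟩ := not_forall.1 htight
  have hlt : Mcnt h S₀ (tbt S) c < (monoBins S c).card :=
    lt_of_le_of_ne (hS.Mcnt_le_card_monoBins hh hInit c) fun he => hc <| by
      rw [he, monoBins]
      congr!
  obtain ⟨b, hb⟩ := Finset.card_pos.1 (Nat.zero_lt_of_lt hlt)
  obtain ⟨T, hT, hTt, hTw, hTc⟩ := Reachlike.exists_drain hh hInit _ S rfl hS hlt hb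
  obtain ⟨S', hcfg, ht, htt, hw⟩ := ih _ (hn ▸ hTc) T rfl hT
  exact ⟨S', hcfg, ht, htt.trans hTt, hTw.trans hw⟩

/-- from any reachable configuration one can reach, by water-moves, a tight
configuration with the same top-border table. -/
theorem statement_5 {B C : Type*} [Fintype B] [Fintype C] (h : ℕ) (hh : 1 ≤ h)
    (S₀ S : B → List C) (hInit : InitConfig h S₀)
    (hreach : Relation.ReflTransGen (BallMove h) S₀ S) :
    ∃ S' : B → List C, Config h S' ∧ Tight h S₀ S' ∧ tbt S' = tbt S ∧
      Relation.ReflTransGen (WaterMove h) S S' := by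
  exact (reachlike_of_reflTransGen hInit hreach).exists_tight hh hInit _ S rfl
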